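/- Let p ≥ 7 be a prime and ζ ∈ ℂ a primitive p-th root of unity. For integers a, b coprime to p set L_ζ(a,b) = ((ζ^a + 1)/(ζ^a − 1)) · ((ζ^b + 1)/(ζ^b − 1)), where ζ^a denotes the integer power of the nonzero complex number ζ. Let P denote the list of seven integer pairs [(−4,5), (−3,4), (−2,3), (−2,3), (−1,2), (−1,2), (−1,2)]. Suppose (a_i, b_i), i = 1,…,9, are pairs of integers coprime to p satisfying the identity in ℂ: Σ_{i=1}^9 L_ζ(a_i,b_i) = Σ_{(c,d)∈P} L_ζ(c,d) + 8ζ/(ζ − 1)². Then the following equalities hold in the field ZMod p (inverses taken in ZMod p): Σ_{i=1}^9 (a_i b_i)⁻¹ = 30⁻¹; Σ_{i=1}^9 (a_i² + b_i² + 1)(a_i b_i)⁻¹ = −269 · 15⁻¹; and Σ_{i=1}^9 (a_i⁴ + b_i⁴ − 5a_i²b_i² + 3)(a_i b_i)⁻¹ = 1712 · 15⁻¹. -/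

import Mathlib

open Finset

/-- The Lefschetz-number expression `((ζ^a+1)/(ζ^a-1))·((ζ^b+1)/(ζ^b-1))`. -/
noncomputable def Lz (ζ : ℂ) (a b : ℤ) : ℂ :=
  ((ζ ^ a + 1) / (ζ ^ a - 1)) * ((ζ ^ b + 1) / (ζ ^ b - 1))

/-- The rotation data of the seven isolated fixed points of the equivariant
`E8`-plumbing action. -/
def Pdata : Fin 7 → ℤ × ℤ :=
  ![(-4, 5), (-3, 4), (-2, 3), (-2, 3), (-1, 2), (-1, 2), (-1, 2)]

open Polynomial

section TruncatedExp

variable {R : Type*} [CommRing R]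

/-- The exponential of `s * x` truncated after degree five; `d` plays the role of `1 / 120`. -/
def truncExp (d x s : R) : R :=
  1 + s * x + 60 * d * s ^ 2 * x ^ 2 + 20 * d * s ^ 3 * x ^ 3 + 5 * d * s ^ 4 * x ^ 4
    + d * s ^ 5 * x ^ 5

/-- The quotient `(exp (s * x) - 1) / x`, truncated. -/
def truncExpSlope (d x s : R) : R :=
  s + 60 * d * s ^ 2 * x + 20 * d * s ^ 3 * x ^ 2 + 5 * d * s ^ 4 * x ^ 3 + d * s ^ 5 * x ^ 4

/-- The series `x * coth (s * x / 2)`, truncated, where `r` plays the role of `1 / s`. -/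
def truncCoth (d x s r : R) : R :=
  2 * r + 20 * d * s * x ^ 2 - 40 * d ^ 2 * s ^ 3 * x ^ 4

lemma truncExp_sub_one (d x s : R) : truncExp d x s - 1 = x * truncExpSlope d x s := by
  unfold truncExp truncExpSlope; ring

lemma truncExp_mul {d x : R} (hx : x ^ 6 = 0) (hd : 120 * d = 1) (s t : R) :
    truncExp d x s * truncExp d x t = truncExp d x (s + t) := by
  unfold truncExp; grind

lemma truncExp_pow {d x : R} (hx : x ^ 6 = 0) (hd : 120 * d = 1) (n : ℕ) :
    truncExp d x 1 ^ n = truncExp d x n := by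
  induction n with
  | zero => simp [truncExp]
  | succ n ih => rw [pow_succ, ih, truncExp_mul hx hd]; push_cast; rfl

lemma mul_truncExpSlope_mul_truncCoth {d x s r : R} (hx : x ^ 6 = 0) (hd : 120 * d = 1)
    (hs : s * r = 1) :
    x * (truncExpSlope d x s * truncCoth d x s r) = x * (truncExp d x s + 1) := by
  unfold truncExp truncExpSlope truncCoth; grind

lemma mul_truncExp_one {d x : R} (hx : x ^ 6 = 0) (hd : 120 * d = 1) :
    x * (8 * truncExp d x 1) =
      x * (truncExpSlope d x 1 ^ 2 * (8 - 80 * d * x ^ 2 + 4 * d * x ^ 4)) := by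
  unfold truncExp truncExpSlope; grind

lemma isUnit_truncExpSlope {d x s : R} (hx : x ^ 6 = 0) (hs : IsUnit s) :
    IsUnit (truncExpSlope d x s) := by
  have h : truncExpSlope d x s =
      s + x * (60 * d * s ^ 2 + 20 * d * s ^ 3 * x + 5 * d * s ^ 4 * x ^ 2 + d * s ^ 5 * x ^ 3) := by
    unfold truncExpSlope; ring
  rw [h]
  have hn : IsNilpotent x := ⟨6, hx⟩
  exact IsNilpotent.isUnit_add_left_of_commute ((Commute.all _ _).isNilpotent_mul_right hn) hs
    (Commute.all _ _)

end TruncatedExp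

section Residue

lemma truncCoth_mul_truncCoth {K R : Type*} [Field K] [CommRing R] [Algebra K R] {x : R}
    (hx : x ^ 6 = 0)
    (δ : K) {a b : K} (ha : a ≠ 0) (hb : b ≠ 0) :
    truncCoth (algebraMap K R δ) x (algebraMap K R a) (algebraMap K R a⁻¹) *
      truncCoth (algebraMap K R δ) x (algebraMap K R b) (algebraMap K R b⁻¹) =
    algebraMap K R (4 * (a * b)⁻¹) + algebraMap K R (40 * δ * ((a ^ 2 + b ^ 2) * (a * b)⁻¹)) * x ^ 2
      + algebraMap K R (-80 * δ ^ 2 * ((a ^ 4 + b ^ 4 - 5 * a ^ 2 * b ^ 2) * (a * b)⁻¹)) * x ^ 4 := by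
  have ha' : algebraMap K R a * algebraMap K R a⁻¹ = 1 := by
    rw [← map_mul, mul_inv_cancel₀ ha, map_one]
  have hb' : algebraMap K R b * algebraMap K R b⁻¹ = 1 := by
    rw [← map_mul, mul_inv_cancel₀ hb, map_one]
  simp only [truncCoth, mul_inv, map_mul, map_add, map_sub, map_pow, map_neg, map_ofNat]
  generalize algebraMap K R a = s at *
  generalize algebraMap K R a⁻¹ = r at *
  generalize algebraMap K R b = t at *
  generalize algebraMap K R b⁻¹ = q at *
  grind

variable {p : ℕ} [Fact p.Prime] {R : Type*} [CommRing R] [Algebra (ZMod p) R] {d x : R} {ζ : ℂ}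

lemma aeval_truncExp_cyclotomic (hp7 : 7 ≤ p) (hx : x ^ 6 = 0) :
    aeval (truncExp d x 1) (cyclotomic p ℤ) = 0 := by
  have hp : p.Prime := Fact.out
  have h := cyclotomic_mul_prime_eq_pow_of_not_dvd (ZMod p) (n := 1) hp.not_dvd_one
  rw [one_mul, cyclotomic_one] at h
  rw [← aeval_map_algebraMap (ZMod p), map_cyclotomic, h, map_pow, map_sub, aeval_X, map_one,
    truncExp_sub_one, mul_pow, pow_eq_zero_of_le (by lia) hx, zero_mul]

lemma aeval_truncExp_eq_zero (hp7 : 7 ≤ p) (hx : x ^ 6 = 0) (hζ : IsPrimitiveRoot ζ p)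
    {F : ℤ[X]} (hF : aeval ζ F = 0) : aeval (truncExp d x 1) F = 0 := by
  have hpos : 0 < p := by lia
  have h := minpoly.isIntegrallyClosed_dvd (hζ.isIntegral hpos) hF
  rw [← cyclotomic_eq_minpoly hζ hpos] at h
  obtain ⟨G, rfl⟩ := h
  rw [map_mul, aeval_truncExp_cyclotomic hp7 hx, zero_mul]

lemma IsPrimitiveRoot.pow_eq_zpow_of_zmod_eq (hζ : IsPrimitiveRoot ζ p) {A : ℕ} {a : ℤ}
    (h : (A : ZMod p) = a) : ζ ^ A = ζ ^ a := by
  have hζ0 : ζ ≠ 0 := hζ.ne_zero (Fact.out : p.Prime).ne_zero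
  have hdvd : (p : ℤ) ∣ A - a := by
    rw [← ZMod.intCast_zmod_eq_zero_iff_dvd]; simp [h]
  have h1 := (hζ.zpow_eq_one_iff_dvd _).2 hdvd
  rw [zpow_sub₀ hζ0, zpow_natCast] at h1
  exact eq_of_div_eq_one h1

/-- The element `(ζ - 1) (ζ ^ a + 1) / (ζ ^ a - 1)` of `ℤ[ζ]` specializes to
`(exp x - 1) * coth (a * x / 2)`. -/
lemma exists_aeval_eq_cayley (hζ : IsPrimitiveRoot ζ p) (hx : x ^ 6 = 0) (hd : 120 * d = 1)
    {a : ℤ} (ha : (a : ZMod p) ≠ 0) :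
    ∃ P : ℤ[X], aeval ζ P = (ζ - 1) * ((ζ ^ a + 1) / (ζ ^ a - 1)) ∧
      x * aeval (truncExp d x 1) P = x * (truncExpSlope d x 1 *
        truncCoth d x (algebraMap (ZMod p) R a) (algebraMap (ZMod p) R (a : ZMod p)⁻¹)) := by
  set A := (a : ZMod p).val
  set B := ((a : ZMod p)⁻¹).val
  have hA : (A : ZMod p) = a := ZMod.natCast_zmod_val _
  have hB : (B : ZMod p) = (a : ZMod p)⁻¹ := ZMod.natCast_zmod_val _
  have hAB : ((A * B : ℕ) : ZMod p) = 1 := by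
    rw [Nat.cast_mul, hA, hB, mul_inv_cancel₀ ha]
  refine ⟨(X ^ A + 1) * ∑ k ∈ range B, (X ^ A) ^ k, ?_, ?_⟩
  · have hne : ζ ^ a - 1 ≠ 0 := by
      rw [sub_ne_zero, Ne, hζ.zpow_eq_one_iff_dvd, ← ZMod.intCast_zmod_eq_zero_iff_dvd]
      exact ha
    have hgeom := mul_geom_sum (ζ ^ A) B
    rw [← pow_mul, hζ.pow_eq_zpow_of_zmod_eq (A := A * B) (a := 1) (by rw [hAB, Int.cast_one]), zpow_one,
      hζ.pow_eq_zpow_of_zmod_eq hA] at hgeom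
    simp only [map_mul, map_add, map_pow, aeval_X, map_one, map_sum,
      hζ.pow_eq_zpow_of_zmod_eq hA]
    rw [← hgeom]
    field_simp
  · set s := algebraMap (ZMod p) R a
    set r := algebraMap (ZMod p) R (a : ZMod p)⁻¹
    have hsr : s * r = 1 := by rw [← map_mul, mul_inv_cancel₀ ha, map_one]
    have hsA : (A : R) = s := by rw [← map_natCast (algebraMap (ZMod p) R), hA]
    have hpow : truncExp d x 1 ^ A = truncExp d x s := by rw [truncExp_pow hx hd, hsA]
    have hgeom := mul_geom_sum (truncExp d x 1 ^ A) B
    rw [← pow_mul, truncExp_pow hx hd (A * B), ← map_natCast (algebraMap (ZMod p) R), hAB,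
      map_one, hpow, truncExp_sub_one, truncExp_sub_one] at hgeom
    simp only [map_mul, map_add, map_pow, aeval_X, map_one, map_sum, hpow]
    have hcoth := mul_truncExpSlope_mul_truncCoth hx hd hsr
    apply (isUnit_truncExpSlope (d := d) hx (.of_mul_eq_one r hsr)).mul_left_cancel
    linear_combination (truncExp d x s + 1) * hgeom - truncExpSlope d x 1 * hcoth

/-- The product of two Cayley quotients in `ℤ[ζ]`, specialized modulo `x ^ 6`. -/
lemma exists_aeval_eq_Lz (hζ : IsPrimitiveRoot ζ p) (hx : x ^ 6 = 0) {δ : ZMod p}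
    (hδ : 120 * δ = 1) {a b : ℤ} (ha : (a : ZMod p) ≠ 0) (hb : (b : ZMod p) ≠ 0) :
    ∃ P : ℤ[X], aeval ζ P = (ζ - 1) ^ 2 * Lz ζ a b ∧
      x * aeval (truncExp (algebraMap _ R δ) x 1) P =
        truncExpSlope (algebraMap _ R δ) x 1 ^ 2 * (x *
        (algebraMap _ R (4 * ((a * b : ℤ) : ZMod p)⁻¹) +
        algebraMap _ R (40 * δ * (((a ^ 2 + b ^ 2 : ℤ) : ZMod p) *
          ((a * b : ℤ) : ZMod p)⁻¹)) * x ^ 2 +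
        algebraMap _ R (-80 * δ ^ 2 * (((a ^ 4 + b ^ 4 - 5 * a ^ 2 * b ^ 2 : ℤ) : ZMod p) *
          ((a * b : ℤ) : ZMod p)⁻¹)) * x ^ 4)) := by
  have hd : 120 * algebraMap _ R δ = 1 := by
    rw [← map_ofNat (algebraMap (ZMod p) R) 120, ← map_mul, hδ, map_one]
  obtain ⟨P, hPζ, hPx⟩ := exists_aeval_eq_cayley hζ hx hd ha
  obtain ⟨Q, hQζ, hQx⟩ := exists_aeval_eq_cayley hζ hx hd hb
  refine ⟨P * Q, ?_, ?_⟩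
  · rw [map_mul, hPζ, hQζ, Lz]; ring
  · simp only [Int.cast_add, Int.cast_sub, Int.cast_mul, Int.cast_pow, Int.cast_ofNat]
    rw [← truncCoth_mul_truncCoth hx δ ha hb, map_mul]
    linear_combination aeval (truncExp (algebraMap _ R δ) x 1) Q * hPx +
      truncExpSlope (algebraMap _ R δ) x 1 * truncCoth (algebraMap _ R δ) x
        (algebraMap _ R (a : ZMod p)) (algebraMap _ R (a : ZMod p)⁻¹) * hQx

/-- The G-signature identity with a central sphere term, specialized modulo `x ^ 6`. -/
lemma residue_identity (hp7 : 7 ≤ p) (hζ : IsPrimitiveRoot ζ p) (hx : x ^ 6 = 0) {δ : ZMod p}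
    (hδ : 120 * δ = 1) {I J : Type*} [Fintype I] [Fintype J] {a b : I → ℤ} {c e : J → ℤ}
    (ha : ∀ i, (a i : ZMod p) ≠ 0) (hb : ∀ i, (b i : ZMod p) ≠ 0)
    (hc : ∀ j, (c j : ZMod p) ≠ 0) (he : ∀ j, (e j : ZMod p) ≠ 0)
    (hid : ∑ i, Lz ζ (a i) (b i) = ∑ j, Lz ζ (c j) (e j) + 8 * ζ / (ζ - 1) ^ 2) :
    x * (algebraMap _ R (4 * ∑ i, ((a i * b i : ℤ) : ZMod p)⁻¹
        - 4 * ∑ j, ((c j * e j : ℤ) : ZMod p)⁻¹ - 8) +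
      algebraMap _ R (40 * δ * ∑ i, ((a i ^ 2 + b i ^ 2 : ℤ) : ZMod p) *
          ((a i * b i : ℤ) : ZMod p)⁻¹
        - 40 * δ * ∑ j, ((c j ^ 2 + e j ^ 2 : ℤ) : ZMod p) * ((c j * e j : ℤ) : ZMod p)⁻¹
        + 80 * δ) * x ^ 2 +
      algebraMap _ R (-80 * δ ^ 2 * ∑ i, ((a i ^ 4 + b i ^ 4 - 5 * a i ^ 2 * b i ^ 2 : ℤ) : ZMod p) *
          ((a i * b i : ℤ) : ZMod p)⁻¹
        - -80 * δ ^ 2 * ∑ j, ((c j ^ 4 + e j ^ 4 - 5 * c j ^ 2 * e j ^ 2 : ℤ) : ZMod p) *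
          ((c j * e j : ℤ) : ZMod p)⁻¹ - 4 * δ) * x ^ 4) = 0 := by
  have hd : 120 * algebraMap _ R δ = 1 := by
    rw [← map_ofNat (algebraMap (ZMod p) R) 120, ← map_mul, hδ, map_one]
  have hζ1 : ζ - 1 ≠ 0 := sub_ne_zero.2 (hζ.ne_one (by lia))
  choose F hFζ hFx using fun i => exists_aeval_eq_Lz hζ hx hδ (ha i) (hb i)
  choose G hGζ hGx using fun j => exists_aeval_eq_Lz hζ hx hδ (hc j) (he j)
  have hzero : aeval ζ (∑ i, F i - ∑ j, G j - 8 * X) = 0 := by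
    simp only [map_sub, map_sum, map_mul, map_ofNat, aeval_X, hFζ, hGζ, ← mul_sum, hid]
    field_simp
    ring
  have hres := congrArg (x * ·)
    (aeval_truncExp_eq_zero (d := algebraMap _ R δ) hp7 hx hζ hzero)
  simp only [map_sub, map_sum (aeval _), map_mul (aeval _), map_ofNat (aeval _), aeval_X, mul_sub,
    mul_sum, hFx, hGx, mul_zero, mul_truncExp_one hx hd] at hres
  simp only [← mul_sum, sum_add_distrib, ← sum_mul, ← map_sum] at hres
  have hunit : IsUnit (truncExpSlope (algebraMap _ R δ) x 1 ^ 2) :=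
    (isUnit_truncExpSlope hx isUnit_one).pow 2
  apply hunit.mul_left_cancel
  simp only [map_sub, map_add, map_mul (algebraMap (ZMod p) R), map_ofNat] at hres ⊢
  linear_combination hres

end Residue

section Extraction

variable {K : Type*} [Field K]

/-- Vanishing of the coefficients of an even quartic, read off modulo `X ^ 6`. -/
lemma eq_zero_of_root_mul_eq_zero {α β γ : K}
    (h : AdjoinRoot.root (X ^ 6 : K[X]) * (algebraMap K _ α + algebraMap K _ β *
      AdjoinRoot.root (X ^ 6 : K[X]) ^ 2 + algebraMap K _ γ * AdjoinRoot.root (X ^ 6) ^ 4) = 0) :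
    α = 0 ∧ β = 0 ∧ γ = 0 := by
  have h' : AdjoinRoot.mk (X ^ 6 : K[X]) (C α * X ^ 1 + C β * X ^ 3 + C γ * X ^ 5) = 0 := by
    simp only [map_add, map_mul, map_pow, AdjoinRoot.mk_X, AdjoinRoot.mk_C]
    rw [← h, AdjoinRoot.algebraMap_eq]
    ring
  rw [AdjoinRoot.mk_eq_zero, X_pow_dvd_iff] at h'
  have h1 := h' 1 (by lia)
  have h3 := h' 3 (by lia)
  have h5 := h' 5 (by lia)
  simp only [coeff_add, coeff_C_mul, coeff_X_pow] at h1 h3 h5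
  exact ⟨by simpa using h1, by simpa using h3, by simpa using h5⟩

end Extraction

lemma ZMod.natCast_ne_zero_of_dvd_pow {p : ℕ} [Fact p.Prime] (hp7 : 7 ≤ p) {n : ℕ}
    (k : ℕ) (hn : n ∣ 30 ^ k) : (n : ZMod p) ≠ 0 := by
  have hp : p.Prime := Fact.out
  rw [Ne, ZMod.natCast_eq_zero_iff]
  intro h
  have h30 : p ∣ 30 := hp.dvd_of_dvd_pow (h.trans hn)
  have hle : p ≤ 30 := Nat.le_of_dvd (by norm_num) h30
  interval_cases p <;> revert hp <;> revert h30 <;> decide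

/-- Congruences mod `p` for the rotation data `(aᵢ, bᵢ)` of nine isolated fixed
points satisfying the G-signature identity against the `E8`-plumbing extension. -/
theorem stmt4 (p : ℕ) (hp : p.Prime) (hp7 : 7 ≤ p) (ζ : ℂ) (hζ : IsPrimitiveRoot ζ p)
    (a b : Fin 9 → ℤ)
    (ha : ∀ i, IsCoprime (a i) (p : ℤ)) (hb : ∀ i, IsCoprime (b i) (p : ℤ))
    (hid : ∑ i, Lz ζ (a i) (b i)
        = ∑ j, Lz ζ (Pdata j).1 (Pdata j).2 + 8 * ζ / (ζ - 1) ^ 2) :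
    (∑ i, ((a i * b i : ℤ) : ZMod p)⁻¹ = (30 : ZMod p)⁻¹) ∧
    (∑ i, (((a i) ^ 2 + (b i) ^ 2 + 1 : ℤ) : ZMod p) * ((a i * b i : ℤ) : ZMod p)⁻¹
        = -269 * (15 : ZMod p)⁻¹) ∧
    (∑ i, (((a i) ^ 4 + (b i) ^ 4 - 5 * (a i) ^ 2 * (b i) ^ 2 + 3 : ℤ) : ZMod p)
          * ((a i * b i : ℤ) : ZMod p)⁻¹
        = 1712 * (15 : ZMod p)⁻¹) := by
  have : Fact p.Prime := ⟨hp⟩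
  have h2 : (2 : ZMod p) ≠ 0 := ZMod.natCast_ne_zero_of_dvd_pow hp7 1 (n := 2) (by norm_num)
  have h3 : (3 : ZMod p) ≠ 0 := ZMod.natCast_ne_zero_of_dvd_pow hp7 1 (n := 3) (by norm_num)
  have h5 : (5 : ZMod p) ≠ 0 := ZMod.natCast_ne_zero_of_dvd_pow hp7 1 (n := 5) (by norm_num)
  have h4 : (4 : ZMod p) ≠ 0 := ZMod.natCast_ne_zero_of_dvd_pow hp7 2 (n := 4) (by norm_num)
  have h15 : (15 : ZMod p) ≠ 0 := ZMod.natCast_ne_zero_of_dvd_pow hp7 1 (n := 15) (by norm_num)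
  have h30 : (30 : ZMod p) ≠ 0 := ZMod.natCast_ne_zero_of_dvd_pow hp7 1 (n := 30) (by norm_num)
  have h120 : (120 : ZMod p) ≠ 0 :=
    ZMod.natCast_ne_zero_of_dvd_pow hp7 3 (n := 120) (by norm_num)
  have hcop {c : ℤ} (hc : IsCoprime c p) : (c : ZMod p) ≠ 0 := by
    rw [Ne, ZMod.intCast_zmod_eq_zero_iff_dvd]
    intro h
    exact (Nat.prime_iff_prime_int.1 hp).not_isUnit (hc.isUnit_of_dvd' h dvd_rfl)
  have hP (j : Fin 7) : ((Pdata j).1 : ZMod p) ≠ 0 ∧ ((Pdata j).2 : ZMod p) ≠ 0 := by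
    fin_cases j <;> simp [Pdata, h2, h3, h4, h5]
  have hδ : (120 : ZMod p) * 120⁻¹ = 1 := mul_inv_cancel₀ h120
  have hx : AdjoinRoot.root (X ^ 6 : (ZMod p)[X]) ^ 6 = 0 := by
    have h := AdjoinRoot.mk_self (f := (X ^ 6 : (ZMod p)[X]))
    rwa [map_pow, AdjoinRoot.mk_X] at h
  obtain ⟨hα, hβ, hγ⟩ := eq_zero_of_root_mul_eq_zero (residue_identity hp7 hζ hx hδ
    (fun i => hcop (ha i)) (fun i => hcop (hb i)) (fun j => (hP j).1) (fun j => (hP j).2) hid)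
  have hsum2 : ∑ i, (((a i) ^ 2 + (b i) ^ 2 + 1 : ℤ) : ZMod p) * ((a i * b i : ℤ) : ZMod p)⁻¹ =
      ∑ i, (((a i) ^ 2 + (b i) ^ 2 : ℤ) : ZMod p) * ((a i * b i : ℤ) : ZMod p)⁻¹ +
        ∑ i, ((a i * b i : ℤ) : ZMod p)⁻¹ := by
    rw [← sum_add_distrib]
    exact sum_congr rfl fun i _ => by rw [Int.cast_add _ 1, Int.cast_one]; ring
  have hsum4 : ∑ i, (((a i) ^ 4 + (b i) ^ 4 - 5 * (a i) ^ 2 * (b i) ^ 2 + 3 : ℤ) : ZMod p) *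
      ((a i * b i : ℤ) : ZMod p)⁻¹ =
      ∑ i, (((a i) ^ 4 + (b i) ^ 4 - 5 * (a i) ^ 2 * (b i) ^ 2 : ℤ) : ZMod p) *
        ((a i * b i : ℤ) : ZMod p)⁻¹ + 3 * ∑ i, ((a i * b i : ℤ) : ZMod p)⁻¹ := by
    rw [mul_sum, ← sum_add_distrib]
    exact sum_congr rfl fun i _ => by rw [Int.cast_add _ 3, Int.cast_ofNat]; ring
  rw [hsum2, hsum4]
  generalize ∑ i, ((a i * b i : ℤ) : ZMod p)⁻¹ = S at *
  generalize ∑ i, (((a i) ^ 2 + (b i) ^ 2 : ℤ) : ZMod p) * ((a i * b i : ℤ) : ZMod p)⁻¹ = T at *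
  generalize ∑ i, (((a i) ^ 4 + (b i) ^ 4 - 5 * (a i) ^ 2 * (b i) ^ 2 : ℤ) : ZMod p) *
    ((a i * b i : ℤ) : ZMod p)⁻¹ = U at *
  simp only [Pdata, Int.reduceNeg, Int.cast_mul, mul_inv_rev, Fin.sum_univ_seven, Fin.isValue,
    Matrix.cons_val_zero, Int.cast_ofNat, Int.cast_neg, inv_neg, mul_neg, Matrix.cons_val_one,
    Matrix.cons_val, Int.cast_one, inv_one, mul_one, Int.cast_add, Int.cast_pow, even_two,
    Even.neg_pow, one_pow, inv_pow, neg_mul, Int.cast_sub, sub_neg_eq_add] at hα hβ hγ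
  have e2 := mul_inv_cancel₀ h2
  have e3 := mul_inv_cancel₀ h3
  have e4 := mul_inv_cancel₀ h4
  have e5 := mul_inv_cancel₀ h5
  have e15 := mul_inv_cancel₀ h15
  have e30 := mul_inv_cancel₀ h30
  have e120 := mul_inv_cancel₀ h120
  generalize (2 : ZMod p)⁻¹ = u at *
  generalize (3 : ZMod p)⁻¹ = v at *
  generalize (4 : ZMod p)⁻¹ = w at *
  generalize (5 : ZMod p)⁻¹ = z at *
  generalize (15 : ZMod p)⁻¹ = y at *
  generalize (30 : ZMod p)⁻¹ = t at *
  generalize (120 : ZMod p)⁻¹ = δ at *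
  have hS : S = t := by grind
  have hT : T + S = -269 * y := by grind
  have hU : U + 3 * S = 1712 * y := by grind
  exact ⟨hS, hT, hU⟩
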